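/- There exist absolute constants δ₀ ∈ (0,1) and X₀ such that the following holds. Let δ ∈ (0, δ₀], let L, L', D ≥ 1, let S ⊆ ℤ ∩ [−4D, 4D] be a nonempty finite set which is (L, L', D)-diophantine, and let T ∈ ℕ. Let X ≥ X₀ be a further parameter. Suppose D ≥ (L'/δ)^{8L}, T ≥ (L'/δ)^{8L}, and T·D ≤ (δ/L')^{50L}·X. Let H be a positive integer with H ≤ (δ/L')^{50L}·T·D. Let f : ℕ → ℂ be 1-bounded and suppose 𝔼_{n∈[X]} 𝔼_{t,t'∈[T]} 𝔼_{s∈S} f(n+ts)·conj(f(n+t's)) ≥ δ. Then there exists q ∈ ℕ with q ≤ (L'/δ)^{8L} such that ‖f‖_{U¹[X;q,H]} ≥ (δ/L')^{25L}. -/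

import Mathlib

noncomputable section

open Finset

/-- `e(x) = exp(2πix)`. -/
def eC (x : ℝ) : ℂ := Complex.exp (2 * Real.pi * Complex.I * x)

/-- Distance to the nearest integer. -/
def dZ (x : ℝ) : ℝ := |x - (round x : ℝ)|

/-- Uniform average of a complex-valued function over a finite set. -/
def avgC {α : Type*} (s : Finset α) (f : α → ℂ) : ℂ := (∑ x ∈ s, f x) / s.card

/-- Uniform average of a real-valued function over a finite set. -/
def avgR {α : Type*} (s : Finset α) (f : α → ℝ) : ℝ := (∑ x ∈ s, f x) / s.card

/-- A set `S` of integers is `(L, L', D)`-diophantine. -/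
def IsDiophantine (L L' D : ℝ) (S : Finset ℤ) : Prop :=
  ∀ δ θ : ℝ, 0 < δ → δ < 1 / 2 →
    δ ≤ ‖avgC S (fun s => eC (θ * (s : ℝ)))‖ →
    ∃ q : ℕ, 0 < q ∧ (q : ℝ) ≤ (L' / δ) ^ L ∧ dZ ((q : ℝ) * θ) ≤ (L' / δ) ^ L / D

/-- Extension by zero of `f : ℕ → ℂ` to `ℤ`. -/
def ext0 (f : ℕ → ℂ) : ℤ → ℂ := fun m => if 0 ≤ m then f m.toNat else 0

/-- The square of the (uniform) norm `‖f‖_{U¹[X; q, H]}`. -/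
def U1Sq (X q H : ℕ) (f : ℕ → ℂ) : ℝ :=
  avgR (Finset.Icc 1 X)
    (fun n => ‖avgC (Finset.Icc 1 H) (fun h => f (n + h * q))‖ ^ 2)

/-- The norm `‖f‖_{U¹[X; q, H]}`. -/
def U1norm (X q H : ℕ) (f : ℕ → ℂ) : ℝ := Real.sqrt (U1Sq X q H f)

open scoped ComplexConjugate

namespace ZMod

/-- Parseval's identity for the discrete Fourier transform on `ZMod N`. -/
lemma sum_norm_sq_dft {N : ℕ} [NeZero N] (g : ZMod N → ℂ) :
    ∑ k, ‖𝓕 g k‖ ^ 2 = N * ∑ x, ‖g x‖ ^ 2 := by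
  have key : ∑ k, 𝓕 g k * conj (𝓕 g k) = N * ∑ x, g x * conj (g x) := by
    simp_rw [dft_apply, map_sum, Finset.sum_mul_sum, smul_eq_mul, map_mul]
    rw [Finset.sum_comm, Finset.mul_sum]
    refine Finset.sum_congr rfl fun x _ => ?_
    rw [Finset.sum_comm]
    have h : ∀ y, ∑ k : ZMod N, stdAddChar (-(x * k)) * g x *
        (conj (stdAddChar (-(y * k))) * conj (g y)) =
        if y = x then (N : ℂ) * (g x * conj (g x)) else 0 := by
      intro y
      have h1 := AddChar.sum_mulShift (y - x) (isPrimitive_stdAddChar N)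
      have h2 : ∑ k : ZMod N, stdAddChar (-(x * k)) * g x *
          (conj (stdAddChar (-(y * k))) * conj (g y)) =
          (∑ k : ZMod N, stdAddChar (k * (y - x))) * (g x * conj (g y)) := by
        rw [Finset.sum_mul]
        refine Finset.sum_congr rfl fun k _ => ?_
        rw [← AddChar.map_neg_eq_conj, neg_neg,
          show k * (y - x) = -(x * k) + y * k by ring, AddChar.map_add_eq_mul]
        ring
      rw [h2, h1]
      by_cases hxy : y = x
      · simp [hxy, ZMod.card]
      · simp [hxy, sub_eq_zero]
    simp_rw [h]
    simp
  have h3 : ∀ z : ℂ, z * conj z = ((‖z‖ ^ 2 : ℝ) : ℂ) := fun z => by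
    rw [Complex.mul_conj, Complex.normSq_eq_norm_sq]
  simp_rw [h3] at key
  exact_mod_cast key

end ZMod

lemma stdAddChar_mul_intCast {N : ℕ} [NeZero N] (k : ZMod N) (m : ℤ) :
    ZMod.stdAddChar (k * (m : ZMod N)) = eC ((k.val : ℝ) / N * m) := by
  have h : k * (m : ZMod N) = (((k.val : ℤ) * m : ℤ) : ZMod N) := by
    push_cast
    rw [ZMod.natCast_zmod_val]
  rw [h, ZMod.stdAddChar_coe, eC]
  congr 1
  push_cast
  ring

/-- An averaging operator over translates acts on the Fourier side as a multiplier. -/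
lemma sum_norm_sq_avgC_translate {N : ℕ} [NeZero N] {ι : Type*} (s : Finset ι) (m : ι → ℤ)
    (g : ZMod N → ℂ) :
    N * ∑ x, ‖avgC s (fun i => g (x + (m i : ZMod N)))‖ ^ 2 =
      ∑ k, ‖ZMod.dft g k‖ ^ 2 * ‖avgC s (fun i => eC ((k.val : ℝ) / N * m i))‖ ^ 2 := by
  rw [← ZMod.sum_norm_sq_dft]
  refine Finset.sum_congr rfl fun k _ => ?_
  rw [← mul_pow, ← norm_mul]
  congr 2
  simp only [ZMod.dft_apply, avgC, smul_eq_mul]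
  simp_rw [mul_div_assoc', Finset.mul_sum, ← Finset.sum_div]
  congr 1
  rw [Finset.sum_comm]
  refine Finset.sum_congr rfl fun i _ => ?_
  rw [Finset.sum_mul, ← stdAddChar_mul_intCast]
  refine Fintype.sum_equiv (Equiv.addRight (m i : ZMod N)) _ _ fun x => ?_
  simp only [Equiv.coe_addRight]
  rw [show -(x * k) = -((x + (m i : ZMod N)) * k) + k * (m i : ZMod N) by ring,
    AddChar.map_add_eq_mul]
  ring

lemma norm_eC (x : ℝ) : ‖eC x‖ = 1 := by
  rw [eC, show (2 * Real.pi * Complex.I * x : ℂ) = ((2 * Real.pi * x : ℝ) : ℂ) * Complex.I by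
    push_cast; ring]
  exact Complex.norm_exp_ofReal_mul_I _

lemma eC_add (x y : ℝ) : eC (x + y) = eC x * eC y := by
  rw [eC, eC, eC, ← Complex.exp_add]
  congr 1
  push_cast
  ring

lemma conj_eC (x : ℝ) : conj (eC x) = eC (-x) := by
  rw [eC, eC, ← Complex.exp_conj]
  congr 1
  simp [map_ofNat]

lemma eC_intCast (n : ℤ) : eC n = 1 := by
  rw [eC, ← Complex.exp_int_mul_two_pi_mul_I n]
  congr 1
  push_cast
  ring

lemma norm_eC_sub_one_le (x : ℝ) : ‖eC x - 1‖ ≤ 2 * Real.pi * dZ x := by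
  have h : eC x = eC (x - round x) := by
    have h1 := eC_add (x - round x) (round x)
    rw [eC_intCast, mul_one, sub_add_cancel] at h1
    exact h1
  rw [h, eC, show (2 * Real.pi * Complex.I * ((x - round x : ℝ) : ℂ) : ℂ) =
    Complex.I * ((2 * Real.pi * (x - round x) : ℝ) : ℂ) by push_cast; ring]
  refine Real.norm_exp_I_mul_ofReal_sub_one_le.trans_eq ?_
  rw [Real.norm_eq_abs, abs_mul, abs_of_pos Real.two_pi_pos, dZ]

lemma dZ_nonneg (x : ℝ) : 0 ≤ dZ x := abs_nonneg _

lemma dZ_le (x : ℝ) (n : ℤ) : dZ x ≤ |x - n| := round_le x n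

lemma dZ_sub_le (x y : ℝ) : dZ (x - y) ≤ dZ x + dZ y := by
  refine (dZ_le _ (round x - round y)).trans ?_
  rw [dZ, dZ]
  push_cast
  rw [show x - y - ((round x : ℝ) - round y) = (x - round x) - (y - round y) by ring]
  exact abs_sub _ _

lemma dZ_natCast_mul_le (n : ℕ) (x : ℝ) : dZ (n * x) ≤ n * dZ x := by
  refine (dZ_le _ (n * round x)).trans_eq ?_
  rw [dZ]
  push_cast
  rw [← mul_sub, abs_mul, Nat.abs_cast]

lemma dZ_eq_abs {x : ℝ} (h : |x| ≤ 1 / 2) : dZ x = |x| := by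
  refine le_antisymm (by simpa using dZ_le x 0) ?_
  rw [dZ]
  by_cases h0 : round x = 0
  · simp [h0]
  · have h1 : (1 : ℝ) ≤ |(round x : ℝ)| := by exact_mod_cast Int.one_le_abs h0
    have h2 := abs_sub_abs_le_abs_sub (round x : ℝ) x
    rw [abs_sub_comm] at h2
    linarith

lemma dZ_natCast_mul_eq {n : ℕ} {x : ℝ} (h : n * dZ x ≤ 1 / 2) : dZ (n * x) = n * dZ x := by
  have h1 : |(n : ℝ) * (x - round x)| = n * dZ x := by rw [abs_mul, Nat.abs_cast, dZ]
  rw [← h1] at h ⊢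
  rw [← dZ_eq_abs h, dZ, dZ, show (n : ℝ) * (x - round x) = n * x - ((n * round x : ℤ) : ℝ) by
    push_cast; ring, round_sub_intCast]
  push_cast
  ring_nf

/-- A dense subset of `[1, T]` contains two elements at bounded distance. -/
lemma exists_pair_close {η : ℝ} {T : ℕ} {A : Finset ℕ} (hA : A ⊆ Icc 1 T) (hη : 0 < η)
    (hcard : η * T ≤ #A) (hT : 2 < η * T) :
    ∃ a ∈ A, ∃ a' ∈ A, a < a' ∧ ((a' - a : ℕ) : ℝ) ≤ 2 / η := by
  set b := ⌈2 / η⌉₊ with hb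
  have hb1 : 2 / η ≤ b := Nat.le_ceil _
  have hb2 : (b : ℝ) < 2 / η + 1 := Nat.ceil_lt_add_one (by positivity)
  have hb0 : 0 < b := Nat.ceil_pos.2 (by positivity)
  have hlt : #(range (T / b + 1)) < #A := by
    have h1 : ((T / b : ℕ) : ℝ) ≤ η * T / 2 := by
      refine Nat.cast_div_le.trans ?_
      rw [div_le_iff₀ (by positivity)]
      have : (2 : ℝ) ≤ η * b := by rwa [div_le_iff₀' hη] at hb1
      nlinarith [(Nat.cast_nonneg T : (0 : ℝ) ≤ T)]
    rw [card_range]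
    have : ((T / b + 1 : ℕ) : ℝ) < #A := by push_cast at h1 ⊢; linarith
    exact_mod_cast this
  obtain ⟨x, hx, y, hy, hxy, he⟩ := exists_ne_map_eq_of_card_lt_of_maps_to hlt
    (f := fun a => a / b) (fun a ha => by
      have := (mem_Icc.1 (hA ha)).2
      simpa [Nat.lt_succ_iff] using Nat.div_le_div_right this)
  have main : ∀ x ∈ A, ∀ y ∈ A, x < y → x / b = y / b →
      ∃ a ∈ A, ∃ a' ∈ A, a < a' ∧ ((a' - a : ℕ) : ℝ) ≤ 2 / η := by
    intro x hx y hy hlt he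
    refine ⟨x, hx, y, hy, hlt, ?_⟩
    have h1 : y - x + 1 ≤ b := by
      have h2 := Nat.div_add_mod x b
      have h3 := Nat.div_add_mod y b
      have h4 := Nat.mod_lt y hb0
      rw [he] at h2
      omega
    have h2 : ((y - x : ℕ) : ℝ) + 1 ≤ b := by exact_mod_cast h1
    linarith
  rcases lt_or_gt_of_ne hxy with h | h
  · exact main x hx y hy h he
  · exact main y hy x hx h he.symm

/-- Vinogradov-type lemma: if `‖(a - a')α‖` is small for all `a, a'` in a dense subset of `[1, T]`
then `α` has a bounded multiple that is very close to an integer. -/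
lemma exists_dZ_mul_le {α η ε : ℝ} {T : ℕ} {A : Finset ℕ} (hA : A ⊆ Icc 1 T) (hη : 0 < η)
    (hη1 : η ≤ 1) (hcard : η * T ≤ #A) (hT : 8 ≤ η ^ 2 * T) (hε : 32 * ε ≤ η)
    (hd : ∀ a ∈ A, ∀ a' ∈ A, dZ (((a : ℝ) - a') * α) ≤ ε) :
    ∃ q : ℕ, 0 < q ∧ (q : ℝ) ≤ 2 / η ∧ dZ (q * α) ≤ 4 * ε / (η ^ 2 * T) := by
  have hηT : 8 ≤ η * T := by nlinarith [(Nat.cast_nonneg T : (0 : ℝ) ≤ T)]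
  have hT0 : (0 : ℝ) < T := by
    rcases Nat.eq_zero_or_pos T with h | h
    · simp [h] at hηT; linarith
    · exact_mod_cast h
  obtain ⟨a, ha, a', ha', hlt, hq⟩ := exists_pair_close hA hη hcard (by linarith)
  refine ⟨a' - a, by omega, hq, ?_⟩
  have hγε : dZ (((a' - a : ℕ) : ℝ) * α) ≤ ε := by
    rw [Nat.cast_sub hlt.le]
    exact hd a' ha' a ha
  set q := a' - a with hqdef
  have hq0 : 0 < q := by omega
  have hq0' : (0 : ℝ) < q := by exact_mod_cast hq0
  set γ := dZ ((q : ℝ) * α) with hγ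
  have hγ0 : 0 ≤ γ := dZ_nonneg _
  have hε0 : 0 ≤ ε := hγ0.trans hγε
  rcases hγ0.eq_or_lt with h0 | hγpos
  · rw [← h0]; positivity
  set K := ⌊1 / (2 * γ)⌋₊ with hK
  have hK1 : (K : ℝ) ≤ 1 / (2 * γ) := Nat.floor_le (by positivity)
  have hK2 : 1 / (2 * γ) < K + 1 := Nat.lt_floor_add_one _
  have hK3 : 16 ≤ 1 / (2 * γ) := by
    rw [le_div_iff₀ (by positivity)]; linarith
  have hK4 : 1 / (4 * γ) ≤ K := by
    have : 1 / (4 * γ) = 1 / (2 * γ) / 2 := by field_simp; norm_num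
    linarith
  have hK0 : (0 : ℝ) < K := by linarith
  set M := ⌊ε / γ⌋₊ with hM
  have hM1 : (M : ℝ) ≤ ε / γ := Nat.floor_le (by positivity)
  have hcount : #A ≤ (M + 1) * #(range q ×ˢ range (T / q / K + 1)) := by
    refine card_le_mul_card_image_of_maps_to (f := fun a => (a % q, a / q / K)) ?_ _ ?_
    · intro x hx
      have := (mem_Icc.1 (hA hx)).2
      exact mem_product.2 ⟨mem_range.2 (Nat.mod_lt _ hq0), mem_range.2
        (Nat.lt_succ_of_le (Nat.div_le_div_right (Nat.div_le_div_right this)))⟩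
    · rintro ⟨r, j⟩ -
      set F := {a ∈ A | (a % q, a / q / K) = (r, j)} with hF
      rcases F.eq_empty_or_nonempty with he | hne
      · simp [he]
      set x₀ := F.min' hne with hx₀
      have hx₀F : x₀ ∈ F := F.min'_mem hne
      obtain ⟨hx₀A, hx₀e⟩ := mem_filter.1 hx₀F
      obtain ⟨hx₀r, hx₀j⟩ := Prod.mk.inj hx₀e
      have hmap : ∀ x ∈ F, x = x₀ + q * (x / q - x₀ / q) ∧ x / q - x₀ / q ≤ M := by
        intro x hx
        obtain ⟨hxA, hxe⟩ := mem_filter.1 hx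
        obtain ⟨hxr, hxj⟩ := Prod.mk.inj hxe
        have hle : x₀ / q ≤ x / q := Nat.div_le_div_right (F.min'_le x hx)
        have h1 : x = x₀ + q * (x / q - x₀ / q) := by
          have h2 := Nat.div_add_mod x₀ q
          have h3 := Nat.div_add_mod x q
          obtain ⟨c, hc⟩ := Nat.exists_eq_add_of_le hle
          rw [hc, Nat.add_sub_cancel_left]
          rw [hc, mul_add] at h3
          omega
        refine ⟨h1, ?_⟩
        set m := x / q - x₀ / q with hm
        have hmK : m ≤ K := by
          have h2 := Nat.div_add_mod (x₀ / q) K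
          have h3 := Nat.div_add_mod (x / q) K
          have h4 := Nat.mod_lt (x / q) (Nat.cast_pos.1 hK0)
          rw [hx₀j] at h2
          rw [hxj] at h3
          omega
        have hmK' : (m : ℝ) ≤ K := by exact_mod_cast hmK
        have h5 : (m : ℝ) * γ ≤ 1 / 2 := by
          calc (m : ℝ) * γ ≤ 1 / (2 * γ) * γ :=
                mul_le_mul_of_nonneg_right (hmK'.trans hK1) hγ0
            _ = 1 / 2 := by field_simp
        have h6 := dZ_natCast_mul_eq h5
        have h7 := hd x hxA x₀ hx₀A
        have h8 : ((x : ℝ) - x₀) * α = m * (q * α) := by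
          have : (x : ℝ) = x₀ + q * m := by exact_mod_cast h1
          rw [this]; ring
        rw [h8, h6] at h7
        exact Nat.le_floor (by rwa [le_div_iff₀ hγpos])
      calc #F ≤ #(range (M + 1)) := by
            refine card_le_card_of_injOn (fun x => x / q - x₀ / q) ?_ ?_
            · intro x hx
              simpa [Nat.lt_succ_iff] using (hmap x hx).2
            · intro x hx y hy hxy
              rw [(hmap x hx).1, (hmap y hy).1]
              simp only at hxy
              rw [hxy]
        _ = M + 1 := card_range _
  have hcount' : (#A : ℝ) ≤ (ε / γ + 1) * (4 * γ * T + q) := by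
    have h1 : ((T / q / K : ℕ) : ℝ) ≤ T / q / K :=
      Nat.cast_div_le.trans (div_le_div_of_nonneg_right Nat.cast_div_le hK0.le)
    have h2 : (T : ℝ) / K ≤ 4 * γ * T := by
      rw [div_le_iff₀ hK0]
      have : 1 ≤ K * (4 * γ) := by rwa [div_le_iff₀ (by positivity)] at hK4
      nlinarith
    have h3 : (q : ℝ) * ((T / q / K : ℕ) + 1) ≤ 4 * γ * T + q := by
      calc (q : ℝ) * ((T / q / K : ℕ) + 1) ≤ q * (T / q / K + 1) := by gcongr
        _ = T / K + q := by field_simp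
        _ ≤ _ := by linarith
    calc (#A : ℝ) ≤ ((M + 1) * (q * (T / q / K + 1)) : ℕ) := by
          rw [card_product, card_range, card_range] at hcount
          exact_mod_cast hcount
      _ = (M + 1) * (q * ((T / q / K : ℕ) + 1)) := by push_cast; ring
      _ ≤ _ := by gcongr
  have h1 : (ε / γ + 1) * (4 * γ * T + q) = 4 * ε * T + 4 * γ * T + q * ε / γ + q := by
    field_simp
    ring
  have h2 : (q : ℝ) ≤ η * T / 4 := by
    refine hq.trans ?_
    rw [div_le_iff₀ hη]
    nlinarith
  have h3 : 4 * ε * T + 4 * γ * T ≤ η * T / 4 := by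
    nlinarith [mul_le_mul_of_nonneg_right hγε hT0.le, mul_le_mul_of_nonneg_right hε hT0.le]
  have h4 : η * T / 2 ≤ q * ε / γ := by linarith
  rw [le_div_iff₀ hγpos] at h4
  rw [le_div_iff₀ (by positivity)]
  have h5 : (q : ℝ) * η ≤ 2 := by rwa [le_div_iff₀ hη] at hq
  have h6 := mul_le_mul_of_nonneg_right h5 hε0
  nlinarith [mul_le_mul_of_nonneg_left h4 hη.le]

lemma norm_sum_eC_sq_sum_le (S : Finset ℤ) (T : ℕ) (θ : ℝ) :
    ∑ s ∈ S, ‖∑ t ∈ Icc 1 T, eC (θ * ((t * s : ℤ) : ℝ))‖ ^ 2 ≤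
      ∑ t' ∈ Icc 1 T, ∑ t ∈ Icc 1 T, ‖∑ s ∈ S, eC (((t : ℝ) - t') * θ * s)‖ := by
  have h : ((∑ s ∈ S, ‖∑ t ∈ Icc 1 T, eC (θ * ((t * s : ℤ) : ℝ))‖ ^ 2 : ℝ) : ℂ) =
      ∑ t' ∈ Icc 1 T, ∑ t ∈ Icc 1 T, ∑ s ∈ S, eC (((t : ℝ) - t') * θ * s) := by
    push_cast
    have h1 : ∀ s ∈ S, (‖∑ t ∈ Icc 1 T, eC (θ * ((t * s : ℤ) : ℝ))‖ ^ 2 : ℂ) =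
        ∑ t' ∈ Icc 1 T, ∑ t ∈ Icc 1 T, eC (((t : ℝ) - t') * θ * s) := by
      intro s _
      rw [← Complex.mul_conj', map_sum, Finset.sum_mul_sum, Finset.sum_comm]
      refine Finset.sum_congr rfl fun t' _ => Finset.sum_congr rfl fun t _ => ?_
      rw [conj_eC, ← eC_add]
      congr 1
      push_cast
      ring
    have h2 := Finset.sum_congr rfl h1
    push_cast at h2
    rw [h2, Finset.sum_comm]
    refine Finset.sum_congr rfl fun t' _ => ?_
    rw [Finset.sum_comm]
  have h0 : 0 ≤ ∑ s ∈ S, ‖∑ t ∈ Icc 1 T, eC (θ * ((t * s : ℤ) : ℝ))‖ ^ 2 := by positivity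
  rw [← abs_of_nonneg h0, ← Real.norm_eq_abs, ← Complex.norm_real, h]
  refine (norm_sum_le _ _).trans (Finset.sum_le_sum fun t' _ => norm_sum_le _ _)

lemma norm_avgC_le_one {α : Type*} (s : Finset α) {f : α → ℂ} (hf : ∀ i ∈ s, ‖f i‖ ≤ 1) :
    ‖avgC s f‖ ≤ 1 := by
  rw [avgC, norm_div, Complex.norm_natCast]
  refine div_le_one_of_le₀ ?_ (Nat.cast_nonneg _)
  simpa using norm_sum_le_of_le s hf

/-- If the Fourier multiplier of the averages along `t * s` is large at `θ`, then `θ` is close to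
a rational with small denominator. -/
lemma exists_denominator {δ L L' D θ : ℝ} {S : Finset ℤ} {T : ℕ} (hδ : 0 < δ) (hδ1 : δ ≤ 1 / 256)
    (hL : 1 ≤ L) (hL' : 1 ≤ L') (hS : S.Nonempty) (hdio : IsDiophantine L L' D S)
    (hD : ((L' / δ) ^ L) ^ 8 ≤ D) (hT : ((L' / δ) ^ L) ^ 8 ≤ T)
    (hθ : δ / 2 ≤ avgR S fun s => ‖avgC (Icc 1 T) fun t => eC (θ * ((t * s : ℤ) : ℝ))‖ ^ 2) :
    ∃ q : ℕ, 0 < q ∧ (q : ℝ) ≤ ((L' / δ) ^ L) ^ 8 ∧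
      dZ (q * θ) ≤ 128 * ((L' / δ) ^ L) ^ 8 / (T * D) := by
  set Z := L' / δ with hZ
  have hZ1 : 1 / δ ≤ Z := div_le_div_of_nonneg_right hL' hδ.le
  have hZ256 : 256 ≤ Z := by
    refine le_trans ?_ hZ1
    rw [le_div_iff₀ hδ]; linarith
  set Y := Z ^ L with hY
  have hZY : Z ≤ Y := by
    simpa using Real.rpow_le_rpow_of_exponent_le (by linarith : 1 ≤ Z) hL
  have hY256 : 256 ≤ Y := hZ256.trans hZY
  have hY0 : 0 < Y := by linarith
  have hδY : 1 ≤ δ * Y := by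
    have := hZ1.trans hZY
    rwa [div_le_iff₀' hδ] at this
  have hP : (L' / (δ / 4)) ^ L ≤ Y ^ 2 := by
    have h1 : L' / (δ / 4) = 4 * Z := by rw [hZ]; field_simp
    rw [h1, hY, ← Real.rpow_natCast, ← Real.rpow_mul (by linarith), mul_comm L,
      Real.rpow_mul (by linarith)]
    refine Real.rpow_le_rpow (by linarith) ?_ (by linarith)
    norm_num
    nlinarith
  have hT0 : (0 : ℝ) < T := lt_of_lt_of_le (by positivity) hT
  have hD0 : 0 < D := lt_of_lt_of_le (by positivity) hD
  have hS0 : (0 : ℝ) < #S := by exact_mod_cast hS.card_pos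
  -- a shift with many large exponential sums
  obtain ⟨t', -, ht'⟩ : ∃ t' ∈ Icc 1 T,
      δ / 2 * #S * T ≤ ∑ t ∈ Icc 1 T, ‖∑ s ∈ S, eC (((t : ℝ) - t') * θ * s)‖ := by
    refine Finset.exists_le_of_sum_le ⟨1, ?_⟩ ?_
    · rw [mem_Icc]
      exact ⟨le_rfl, Nat.cast_pos.1 hT0⟩
    refine le_trans ?_ (norm_sum_eC_sq_sum_le S T θ)
    have h1 : (avgR S fun s => ‖avgC (Icc 1 T) fun t => eC (θ * ((t * s : ℤ) : ℝ))‖ ^ 2) =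
        (∑ s ∈ S, ‖∑ t ∈ Icc 1 T, eC (θ * ((t * s : ℤ) : ℝ))‖ ^ 2) / T ^ 2 / #S := by
      simp only [avgR, avgC, norm_div, Complex.norm_natCast, Nat.card_Icc, div_pow,
        Nat.add_sub_cancel, ← Finset.sum_div]
    rw [h1, le_div_iff₀ hS0, le_div_iff₀ (by positivity)] at hθ
    simp only [sum_const, Nat.card_Icc, Nat.add_sub_cancel, nsmul_eq_mul]
    linarith
  set B : Finset ℕ := {t ∈ Icc 1 T | δ / 4 * #S ≤ ‖∑ s ∈ S, eC (((t : ℝ) - t') * θ * s)‖} with hB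
  have hBcard : δ / 4 * T ≤ #B := by
    have h1 : ∑ t ∈ Icc 1 T, ‖∑ s ∈ S, eC (((t : ℝ) - t') * θ * s)‖ ≤
        ∑ t ∈ Icc 1 T, ((if t ∈ B then (#S : ℝ) else 0) + δ / 4 * #S) := by
      refine Finset.sum_le_sum fun t ht => ?_
      split_ifs with h
      · have := norm_sum_le_of_le S (f := fun s : ℤ => eC (((t : ℝ) - t') * θ * s))
          (n := fun _ => (1 : ℝ)) (fun s _ => (norm_eC _).le)
        simp only [sum_const, nsmul_eq_mul, mul_one] at this
        have : 0 ≤ δ / 4 * #S := by positivity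
        linarith
      · have : ¬ δ / 4 * #S ≤ ‖∑ s ∈ S, eC (((t : ℝ) - t') * θ * s)‖ :=
          fun h' => h (mem_filter.2 ⟨ht, h'⟩)
        linarith
    have h2 : ∑ t ∈ Icc 1 T, (if t ∈ B then (#S : ℝ) else 0) = #B * #S := by
      rw [← Finset.sum_filter, Finset.filter_mem_eq_inter,
        Finset.inter_eq_right.2 (Finset.filter_subset _ _), sum_const, nsmul_eq_mul]
    rw [Finset.sum_add_distrib, h2] at h1
    simp only [sum_const, Nat.card_Icc, Nat.add_sub_cancel, nsmul_eq_mul] at h1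
    have h3 : δ / 4 * T * #S ≤ #B * #S := by linarith
    exact le_of_mul_le_mul_right h3 hS0
  have hq : ∀ t ∈ B, ∃ q : ℕ, (0 < q ∧ (q : ℝ) ≤ Y ^ 2) ∧
      dZ (q * (((t : ℝ) - t') * θ)) ≤ Y ^ 2 / D := by
    intro t ht
    obtain ⟨q, hq0, hq1, hq2⟩ := hdio (δ / 4) (((t : ℝ) - t') * θ) (by linarith) (by linarith) (by
      rw [avgC, norm_div, Complex.norm_natCast, le_div_iff₀ hS0]
      exact (mem_filter.1 ht).2)
    exact ⟨q, ⟨hq0, hq1.trans hP⟩, hq2.trans (div_le_div_of_nonneg_right hP hD0.le)⟩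
  choose! r hr hr' using hq
  have hfloor : (⌊Y ^ 2⌋₊ : ℝ) ≤ Y ^ 2 := Nat.floor_le (by positivity)
  obtain ⟨q₀, hq₀, hA⟩ := Finset.exists_le_card_fiber_of_nsmul_le_card_of_maps_to
    (s := B) (t := Icc 1 ⌊Y ^ 2⌋₊) (f := r) (b := δ / (4 * Y ^ 2) * T)
    (fun t ht => mem_Icc.2 ⟨(hr t ht).1, Nat.le_floor (hr t ht).2⟩)
    ⟨1, mem_Icc.2 ⟨le_rfl, Nat.le_floor (by push_cast; nlinarith)⟩⟩ (by
      rw [nsmul_eq_mul, Nat.card_Icc, Nat.add_sub_cancel]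
      refine le_trans ?_ hBcard
      calc (⌊Y ^ 2⌋₊ : ℝ) * (δ / (4 * Y ^ 2) * T) ≤ Y ^ 2 * (δ / (4 * Y ^ 2) * T) := by gcongr
        _ = δ / 4 * T := by field_simp)
  obtain ⟨hq₀1, hq₀2⟩ := mem_Icc.1 hq₀
  have hq₀2' : (q₀ : ℝ) ≤ Y ^ 2 := le_trans (by exact_mod_cast hq₀2) hfloor
  obtain ⟨q, hq1, hq2, hq3⟩ := exists_dZ_mul_le (α := q₀ * θ) (η := δ / (4 * Y ^ 2))
    (ε := 2 * Y ^ 2 / D) (T := T) (A := {t ∈ B | r t = q₀})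
    ((filter_subset _ _).trans (filter_subset _ _)) (by positivity)
    (by rw [div_le_one (by positivity)]; nlinarith) hA
    (by
      have h1 : 1 ≤ (δ * Y) ^ 2 := one_le_pow₀ hδY
      rw [div_pow, div_mul_eq_mul_div, le_div_iff₀ (by positivity)]
      calc 8 * (4 * Y ^ 2) ^ 2 = 128 * Y ^ 4 * 1 := by ring
        _ ≤ 128 * Y ^ 4 * (δ * Y) ^ 2 := by gcongr
        _ = δ ^ 2 * (128 * Y ^ 6) := by ring
        _ ≤ δ ^ 2 * (Y ^ 2 * Y ^ 6) := by gcongr; nlinarith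
        _ = δ ^ 2 * Y ^ 8 := by ring
        _ ≤ δ ^ 2 * T := by gcongr)
    (by
      rw [mul_div_assoc', div_le_div_iff₀ hD0 (by positivity)]
      calc 32 * (2 * Y ^ 2) * (4 * Y ^ 2) = 256 * Y ^ 4 * 1 := by ring
        _ ≤ Y * Y ^ 4 * (δ * Y) := by gcongr
        _ = δ * Y ^ 6 := by ring
        _ ≤ δ * Y ^ 8 := by gcongr <;> linarith
        _ ≤ δ * D := by gcongr)
    (by
      intro a ha a' ha'
      obtain ⟨haB, har⟩ := mem_filter.1 ha
      obtain ⟨haB', har'⟩ := mem_filter.1 ha'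
      have h1 := hr' a haB
      have h2 := hr' a' haB'
      rw [har] at h1
      rw [har'] at h2
      have h3 := dZ_sub_le (q₀ * (((a : ℝ) - t') * θ)) (q₀ * (((a' : ℝ) - t') * θ))
      rw [show (q₀ * (((a : ℝ) - t') * θ)) - (q₀ * (((a' : ℝ) - t') * θ)) =
        ((a : ℝ) - a') * (q₀ * θ) by ring] at h3
      have h4 : 2 * Y ^ 2 / D = Y ^ 2 / D + Y ^ 2 / D := by ring
      linarith)
  refine ⟨q * q₀, Nat.mul_pos hq1 hq₀1, ?_, ?_⟩
  · push_cast
    calc (q : ℝ) * q₀ ≤ (2 / (δ / (4 * Y ^ 2))) * Y ^ 2 := by gcongr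
      _ = 8 * Y ^ 4 / δ := by field_simp; norm_num
      _ ≤ Y ^ 8 := by
        rw [div_le_iff₀ hδ]
        calc 8 * Y ^ 4 ≤ Y * Y ^ 4 * 1 := by nlinarith [pow_pos hY0 4]
          _ ≤ Y * Y ^ 4 * (δ * Y) := by gcongr
          _ = Y ^ 6 * δ := by ring
          _ ≤ Y ^ 8 * δ := by gcongr <;> linarith
  · push_cast
    rw [mul_assoc]
    refine hq3.trans ?_
    have h1 : 1 ≤ (δ * Y) ^ 2 := one_le_pow₀ hδY
    calc 4 * (2 * Y ^ 2 / D) / ((δ / (4 * Y ^ 2)) ^ 2 * T)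
        = 128 * Y ^ 6 / δ ^ 2 / (T * D) := by field_simp; norm_num
      _ ≤ 128 * Y ^ 8 / (T * D) := by
        gcongr
        rw [div_le_iff₀ (by positivity)]
        calc 128 * Y ^ 6 = 128 * Y ^ 6 * 1 := by ring
          _ ≤ 128 * Y ^ 6 * (δ * Y) ^ 2 := by gcongr
          _ = 128 * Y ^ 8 * δ ^ 2 := by ring

lemma avgC_avgC_avgC_mul_conj {ι κ : Type*} (A : Finset ι) (S : Finset κ) (a : ι → κ → ℂ) :
    avgC A (fun t => avgC A fun t' => avgC S fun s => a t s * conj (a t' s)) =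
      ((avgR S fun s => ‖avgC A fun t => a t s‖ ^ 2 : ℝ) : ℂ) := by
  simp only [avgR, avgC]
  push_cast
  have h : ∀ s ∈ S, (‖(∑ t ∈ A, a t s) / (#A : ℂ)‖ ^ 2 : ℂ) =
      (∑ t ∈ A, ∑ t' ∈ A, a t s * conj (a t' s)) / #A / #A := by
    intro s _
    rw [← Complex.mul_conj', map_div₀, map_sum, Complex.conj_natCast, div_mul_div_comm,
      Finset.sum_mul_sum, div_div]
  rw [Finset.sum_congr rfl h]
  simp_rw [← Finset.sum_div]
  simp_rw [Finset.sum_comm (s := S) (t := A)]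
  field_simp

lemma avgC_ofReal_re {ι : Type*} (A : Finset ι) (a : ι → ℝ) :
    (avgC A fun i => (a i : ℂ)).re = avgR A a := by
  rw [avgC, avgR, ← Complex.ofReal_sum, ← Complex.ofReal_natCast, ← Complex.ofReal_div,
    Complex.ofReal_re]

lemma avgR_le {ι : Type*} {A : Finset ι} (hA : A.Nonempty) {a : ι → ℝ} {c : ℝ}
    (h : ∀ i ∈ A, a i ≤ c) : avgR A a ≤ c := by
  rw [avgR, div_le_iff₀ (by exact_mod_cast hA.card_pos), mul_comm, ← nsmul_eq_mul]
  exact Finset.sum_le_card_nsmul _ _ _ h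

lemma half_le_norm_avgC {ι : Type*} {A : Finset ι} (hA : A.Nonempty) {a : ι → ℂ}
    (h : ∀ i ∈ A, ‖a i - 1‖ ≤ 1 / 2) : 1 / 2 ≤ ‖avgC A a‖ := by
  have hA0 : (0 : ℝ) < #A := by exact_mod_cast hA.card_pos
  have h1 := norm_sum_le_of_le A h
  rw [Finset.sum_sub_distrib, sum_const, sum_const, nsmul_eq_mul, mul_one, nsmul_eq_mul] at h1
  have h2 := norm_sub_norm_le (#A : ℂ) (∑ i ∈ A, a i)
  rw [norm_sub_rev, Complex.norm_natCast] at h2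
  rw [avgC, norm_div, Complex.norm_natCast, le_div_iff₀ hA0]
  linarith

lemma ZMod.sum_eq_sum_range {N : ℕ} [NeZero N] (F : ZMod N → ℝ) :
    ∑ x, F x = ∑ n ∈ range N, F n := by
  refine Finset.sum_nbij' (fun x => x.val) (fun n => (n : ZMod N)) ?_ ?_ ?_ ?_ ?_
  · intro x _
    exact mem_range.2 (ZMod.val_lt x)
  · intro n _
    exact mem_univ _
  · intro x _
    exact ZMod.natCast_zmod_val x
  · intro n hn
    exact ZMod.val_cast_of_lt (mem_range.1 hn)
  · intro x _
    simp only [ZMod.natCast_zmod_val]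

lemma Icc_one_subset_range {X N : ℕ} (h : X < N) : Icc 1 X ⊆ range N := fun n hn => by
  have := (mem_Icc.1 hn).2
  rw [mem_range]
  omega

lemma sum_Icc_le_sum_zmod {N X : ℕ} [NeZero N] (h : X < N) {F : ZMod N → ℝ} (hF : ∀ x, 0 ≤ F x) :
    ∑ n ∈ Icc 1 X, F n ≤ ∑ x, F x := by
  rw [ZMod.sum_eq_sum_range]
  exact Finset.sum_le_sum_of_subset_of_nonneg (Icc_one_subset_range h) fun _ _ _ => hF _

lemma sum_zmod_le_sum_Icc {N X : ℕ} [NeZero N] (h : X < N) {F : ZMod N → ℝ} (hF : ∀ x, F x ≤ 1) :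
    ∑ x, F x ≤ ∑ n ∈ Icc 1 X, F n + (N - X) := by
  rw [ZMod.sum_eq_sum_range, ← Finset.sum_sdiff (Icc_one_subset_range h), add_comm]
  gcongr
  refine (Finset.sum_le_card_nsmul _ _ 1 fun x _ => hF _).trans_eq ?_
  rw [card_sdiff_of_subset (Icc_one_subset_range h), card_range, Nat.card_Icc,
    Nat.add_sub_cancel, nsmul_eq_mul, mul_one, Nat.cast_sub h.le]

/-- The restriction of `f` to `[0, M]`, viewed as a function on `ZMod N`. -/
def truncZMod (N M : ℕ) (f : ℕ → ℂ) (x : ZMod N) : ℂ := if x.val ≤ M then f x.val else 0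

lemma norm_truncZMod_le {N M : ℕ} {f : ℕ → ℂ} (hf : ∀ n, ‖f n‖ ≤ 1) (x : ZMod N) :
    ‖truncZMod N M f x‖ ≤ 1 := by
  rw [truncZMod]
  split_ifs
  · exact hf _
  · simp

lemma truncZMod_intCast {N M B : ℕ} [NeZero N] (hN : M + B < N) (f : ℕ → ℂ) {m : ℤ}
    (hm : -B ≤ m) (hm' : m ≤ M) : truncZMod N M f (m : ZMod N) = ext0 f m := by
  rcases le_or_gt 0 m with h | h
  · obtain ⟨n, rfl⟩ := Int.eq_ofNat_of_zero_le h
    have h1 : ((n : ℤ) : ZMod N).val = n := by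
      rw [Int.cast_natCast]
      exact ZMod.val_cast_of_lt (by omega)
    rw [truncZMod, ext0, h1, if_pos (by omega), if_pos h, Int.toNat_natCast]
  · obtain ⟨n, hn⟩ := Int.eq_ofNat_of_zero_le (show 0 ≤ (N : ℤ) + m by omega)
    have h1 : (m : ZMod N).val = n := by
      have : (m : ZMod N) = (n : ZMod N) := by
        rw [← Int.cast_natCast, ← hn]
        simp
      rw [this]
      exact ZMod.val_cast_of_lt (by omega)
    rw [truncZMod, ext0, h1, if_neg (by omega), if_neg (by omega)]

/-- Transfer of the averages along `t * s` to the Fourier side on `ZMod N`. -/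
lemma avg_le_sum_dft {N M B X T : ℕ} [NeZero N] (hXM : X + B ≤ M) (hN : M + B < N)
    {S : Finset ℤ} (hS : ∀ s ∈ S, (T : ℤ) * |s| ≤ B) (f : ℕ → ℂ) :
    N * ∑ n ∈ Icc 1 X, avgR S (fun s =>
        ‖avgC (Icc 1 T) fun t => ext0 f ((n : ℤ) + (t : ℤ) * s)‖ ^ 2) ≤
      ∑ k, ‖ZMod.dft (truncZMod N M f) k‖ ^ 2 * avgR S (fun s =>
        ‖avgC (Icc 1 T) fun t => eC ((k.val : ℝ) / N * ((t * s : ℤ) : ℝ))‖ ^ 2) := by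
  simp only [avgR, ← Finset.sum_div, mul_div_assoc', Finset.mul_sum]
  gcongr
  rw [Finset.sum_comm, Finset.sum_comm (s := univ)]
  refine Finset.sum_le_sum fun s hs => ?_
  rw [← sum_norm_sq_avgC_translate (Icc 1 T) (fun t : ℕ => (t : ℤ) * s), ← Finset.mul_sum]
  gcongr
  refine le_trans (Finset.sum_le_sum fun n hn => ?_) (sum_Icc_le_sum_zmod (by omega : X < N)
    (F := fun x => ‖avgC (Icc 1 T) fun t : ℕ =>
      truncZMod N M f (x + (((t : ℤ) * s : ℤ) : ZMod N))‖ ^ 2) fun x => by positivity)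
  refine le_of_eq ?_
  congr 2
  rw [avgC, avgC]
  congr 1
  refine Finset.sum_congr rfl fun t ht => ?_
  have hn' := mem_Icc.1 hn
  have ht' := mem_Icc.1 ht
  have h1 : |(t : ℤ) * s| ≤ B := by
    rw [abs_mul, Nat.abs_cast]
    refine le_trans ?_ (hS s hs)
    gcongr
    exact ht'.2
  obtain ⟨h2, h3⟩ := abs_le.1 h1
  rw [← truncZMod_intCast hN f (m := (n : ℤ) + t * s) (by omega) (by omega)]
  push_cast
  rfl

lemma sum_zmod_le_U1Sq {N M X H q : ℕ} [NeZero N] (hXN : X < N) (hMN : M < N)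
    (hX : 0 < X) (hH : X + H * q ≤ M) {f : ℕ → ℂ} (hf : ∀ n, ‖f n‖ ≤ 1) :
    ∑ x : ZMod N, ‖avgC (Icc 1 H) fun h : ℕ =>
        truncZMod N M f (x + (((h : ℤ) * q : ℤ) : ZMod N))‖ ^ 2 ≤ X * U1Sq X q H f + (N - X) := by
  refine (sum_zmod_le_sum_Icc hXN (F := fun x => ‖avgC (Icc 1 H) fun h : ℕ =>
        truncZMod N M f (x + (((h : ℤ) * q : ℤ) : ZMod N))‖ ^ 2) fun x => ?_).trans_eq ?_
  · exact pow_le_one₀ (norm_nonneg _) (norm_avgC_le_one _ fun _ _ => norm_truncZMod_le hf _)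
  have hX' : (X : ℝ) ≠ 0 := by positivity
  rw [U1Sq, avgR, Nat.card_Icc, Nat.add_sub_cancel, mul_div_cancel₀ _ hX']
  congr 1
  refine Finset.sum_congr rfl fun n hn => ?_
  congr 2
  rw [avgC, avgC]
  congr 1
  refine Finset.sum_congr rfl fun h hh => ?_
  have hn' := (mem_Icc.1 hn).2
  have hh' : h * q ≤ H * q := Nat.mul_le_mul_right _ (mem_Icc.1 hh).2
  have h1 : ((n : ZMod N) + (((h : ℤ) * q : ℤ) : ZMod N)) = ((n + h * q : ℕ) : ZMod N) := by
    push_cast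
    rfl
  rw [h1, truncZMod, ZMod.val_cast_of_lt (by omega), if_pos (by omega)]

/-- Lower bound for a `U¹`-norm from Fourier mass at frequencies where all phases `h * q * θ`,
`h ≤ H`, are close to integers. -/
lemma le_U1Sq_of_sum_dft {N M X H q : ℕ} [NeZero N] (hXN : X < N) (hMN : M < N)
    (hX : 0 < X) (hH0 : 0 < H) (hH : X + H * q ≤ M) {f : ℕ → ℂ} (hf : ∀ n, ‖f n‖ ≤ 1)
    (Θ : Finset (ZMod N)) (hΘ : ∀ k ∈ Θ, H * dZ (q * ((k.val : ℝ) / N)) ≤ 1 / 16) :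
    (∑ k ∈ Θ, ‖ZMod.dft (truncZMod N M f) k‖ ^ 2) / 4 ≤ N * (X * U1Sq X q H f + (N - X)) := by
  refine le_trans ?_ (mul_le_mul_of_nonneg_left (sum_zmod_le_U1Sq hXN hMN hX hH hf)
    (Nat.cast_nonneg N))
  rw [sum_norm_sq_avgC_translate (Icc 1 H) (fun h : ℕ => (h : ℤ) * q), Finset.sum_div]
  refine le_trans (Finset.sum_le_sum fun k hk => ?_)
    (Finset.sum_le_sum_of_subset_of_nonneg (Finset.subset_univ Θ) fun _ _ _ => by positivity)
  have h1 : 1 / 2 ≤ ‖avgC (Icc 1 H) fun h : ℕ =>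
      eC ((k.val : ℝ) / N * (((h : ℤ) * q : ℤ) : ℝ))‖ := by
    refine half_le_norm_avgC ⟨1, mem_Icc.2 ⟨le_rfl, hH0⟩⟩ fun h hh => ?_
    refine (norm_eC_sub_one_le _).trans ?_
    have h2 : (k.val : ℝ) / N * (((h : ℤ) * q : ℤ) : ℝ) = h * (q * ((k.val : ℝ) / N)) := by
      push_cast
      ring
    have h3 : (h : ℝ) ≤ H := by exact_mod_cast (mem_Icc.1 hh).2
    have h4 := hΘ k hk
    have h5 := dZ_natCast_mul_le h (q * ((k.val : ℝ) / N))
    have h6 := mul_le_mul_of_nonneg_right h3 (dZ_nonneg (q * ((k.val : ℝ) / N)))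
    rw [h2]
    nlinarith [Real.pi_le_four, Real.pi_pos, dZ_nonneg (h * (q * ((k.val : ℝ) / N)))]
  have h2 : (1 / 2 : ℝ) ^ 2 ≤ ‖avgC (Icc 1 H) fun h : ℕ =>
      eC ((k.val : ℝ) / N * (((h : ℤ) * q : ℤ) : ℝ))‖ ^ 2 := by gcongr
  calc ‖ZMod.dft (truncZMod N M f) k‖ ^ 2 / 4 =
        ‖ZMod.dft (truncZMod N M f) k‖ ^ 2 * (1 / 2 : ℝ) ^ 2 := by ring
    _ ≤ _ := by gcongr

/-- Sharing the mass of the frequencies with large multiplier among the possible denominators. -/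
lemma exists_large_class {ι : Type*} [Fintype ι] {δ Q C : ℝ} (hδ : 0 ≤ δ) (hQ : 1 ≤ Q) (hC : 0 ≤ C)
    {g w : ι → ℝ} (hg : ∀ k, 0 ≤ g k) (hw : ∀ k, w k ≤ 1)
    (hgw : δ / 2 * ∑ k, g k + C ≤ ∑ k, g k * w k) {P : ℕ → ι → Prop}
    (hP : ∀ k, δ / 2 ≤ w k → ∃ q : ℕ, 0 < q ∧ (q : ℝ) ≤ Q ∧ P q k) :
    ∃ q : ℕ, 0 < q ∧ (q : ℝ) ≤ Q ∧
      ∃ Θ : Finset ι, (∀ k ∈ Θ, P q k) ∧ C / Q ≤ ∑ k ∈ Θ, g k := by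
  classical
  set Θ : Finset ι := {k | δ / 2 ≤ w k} with hΘ
  have hmass : C ≤ ∑ k ∈ Θ, g k := by
    have h1 : ∑ k, g k * w k ≤ ∑ k, ((if δ / 2 ≤ w k then g k else 0) + δ / 2 * g k) := by
      refine Finset.sum_le_sum fun k _ => ?_
      split_ifs with h
      · nlinarith [mul_nonneg hδ (hg k), mul_nonneg (hg k) (sub_nonneg.2 (hw k))]
      · nlinarith [hg k]
    rw [Finset.sum_add_distrib, ← Finset.sum_filter, ← Finset.mul_sum] at h1
    linarith
  have hP' : ∀ k ∈ Θ, ∃ q : ℕ, (0 < q ∧ (q : ℝ) ≤ Q) ∧ P q k := fun k hk => by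
    obtain ⟨q, h1, h2, h3⟩ := hP k (mem_filter.1 hk).2
    exact ⟨q, ⟨h1, h2⟩, h3⟩
  choose! r hr hr' using hP'
  have hfloor : (⌊Q⌋₊ : ℝ) ≤ Q := Nat.floor_le (by linarith)
  obtain ⟨q, hq, hsum⟩ := Finset.exists_le_sum_fiber_of_maps_to_of_nsmul_le_sum
    (s := Θ) (t := Icc 1 ⌊Q⌋₊) (f := r) (w := g) (b := C / Q)
    (fun k hk => mem_Icc.2 ⟨(hr k hk).1, Nat.le_floor (hr k hk).2⟩)
    ⟨1, mem_Icc.2 ⟨le_rfl, Nat.le_floor (by push_cast; exact hQ)⟩⟩ (by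
      rw [nsmul_eq_mul, Nat.card_Icc, Nat.add_sub_cancel]
      refine le_trans ?_ hmass
      calc (⌊Q⌋₊ : ℝ) * (C / Q) ≤ Q * (C / Q) := by gcongr
        _ = C := by field_simp)
  obtain ⟨hq1, hq2⟩ := mem_Icc.1 hq
  refine ⟨q, hq1, le_trans (by exact_mod_cast hq2) hfloor, _, fun k hk => ?_, hsum⟩
  obtain ⟨h1, h2⟩ := mem_filter.1 hk
  rw [← h2]
  exact hr' k h1

lemma inv_pow_le_of_mass {δ Y X E τ u : ℝ} (hδ : 0 < δ) (hY : 256 ≤ Y) (hδY : 1 ≤ δ * Y)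
    (hX : 0 < X) (hE : E ≤ 11 * τ) (hτ : τ * Y ^ 50 ≤ X)
    (h : δ * X / (12 * Y ^ 8) ≤ X * u + E) : (Y ^ 50)⁻¹ ≤ u := by
  have hY0 : 0 < Y := by linarith
  have h1 : X * (12 * (Y ^ 50)⁻¹) ≤ δ * X / (12 * Y ^ 8) := by
    rw [le_div_iff₀ (by positivity)]
    have h2 : 144 * (Y ^ 50)⁻¹ * Y ^ 8 ≤ δ := by
      rw [mul_right_comm, mul_inv_le_iff₀ (by positivity)]
      calc 144 * Y ^ 8 ≤ Y * Y ^ 8 * 1 := by nlinarith [pow_pos hY0 8]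
        _ ≤ Y * Y ^ 8 * (δ * Y) := by gcongr
        _ = δ * Y ^ 10 := by ring
        _ ≤ δ * Y ^ 50 := by gcongr <;> linarith
    nlinarith [mul_le_mul_of_nonneg_left h2 hX.le]
  have h2 : τ ≤ X * (Y ^ 50)⁻¹ := by
    rwa [← div_eq_mul_inv, le_div_iff₀ (by positivity)]
  have h3 : X * (Y ^ 50)⁻¹ ≤ X * u := by linarith
  exact le_of_mul_le_mul_left h3 hX

/-- Lemma 2.5 of the paper. -/
theorem inverse_concat_uniform :
    ∃ δ₀ : ℝ, δ₀ ∈ Set.Ioo (0 : ℝ) 1 ∧ ∃ X₀ : ℕ,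
      ∀ (δ L L' D : ℝ) (S : Finset ℤ) (T X H : ℕ) (f : ℕ → ℂ),
        0 < δ → δ ≤ δ₀ → 1 ≤ L → 1 ≤ L' → 1 ≤ D →
        S.Nonempty → (∀ s ∈ S, |(s : ℝ)| ≤ 4 * D) →
        IsDiophantine L L' D S →
        X₀ ≤ X →
        (L' / δ) ^ (8 * L) ≤ D →
        (L' / δ) ^ (8 * L) ≤ (T : ℝ) →
        (T : ℝ) * D ≤ (δ / L') ^ (50 * L) * X →
        0 < H → (H : ℝ) ≤ (δ / L') ^ (50 * L) * T * D →
        (∀ n, ‖f n‖ ≤ 1) →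
        δ ≤ (avgC (Finset.Icc 1 X) (fun n =>
              avgC (Finset.Icc 1 T) (fun t =>
                avgC (Finset.Icc 1 T) (fun t' =>
                  avgC S (fun s =>
                    ext0 f ((n : ℤ) + (t : ℤ) * s) *
                      (starRingEnd ℂ) (ext0 f ((n : ℤ) + (t' : ℤ) * s))))))).re →
        ∃ q : ℕ, 0 < q ∧ (q : ℝ) ≤ (L' / δ) ^ (8 * L) ∧
          (δ / L') ^ (25 * L) ≤ U1norm X q H f := by
  refine ⟨1 / 256, ⟨by norm_num, by norm_num⟩, 0, ?_⟩
  intro δ L L' D S T X H f hδ hδ1 hL hL' hD1 hS hSD hdio _ hD hT hTD hH0 hH hf hyp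
  have hZ1 : 1 / δ ≤ L' / δ := div_le_div_of_nonneg_right hL' hδ.le
  have hZ256 : 256 ≤ L' / δ := by
    refine le_trans ?_ hZ1
    rw [le_div_iff₀ hδ]; linarith
  have hZ0 : 0 ≤ L' / δ := by linarith
  have hpow : ∀ n : ℕ, (L' / δ) ^ ((n : ℝ) * L) = ((L' / δ) ^ L) ^ n := fun n => by
    rw [mul_comm, Real.rpow_mul hZ0, Real.rpow_natCast]
  have hpow' : ∀ n : ℕ, (δ / L') ^ ((n : ℝ) * L) = (((L' / δ) ^ L) ^ n)⁻¹ := fun n => by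
    rw [← inv_div L' δ, Real.inv_rpow hZ0, hpow]
  have h8 := hpow 8
  have h50 := hpow' 50
  have h25 := hpow' 25
  push_cast at h8 h50 h25
  rw [h8] at hD hT
  rw [h50] at hTD hH
  rw [h8, h25]
  have hden := fun θ : ℝ => exists_denominator (θ := θ) hδ hδ1 hL hL' hS hdio hD hT
  have hZY : L' / δ ≤ (L' / δ) ^ L := by
    simpa using Real.rpow_le_rpow_of_exponent_le (by linarith : 1 ≤ L' / δ) hL
  set Y := (L' / δ) ^ L with hY
  have hY256 : 256 ≤ Y := hZ256.trans hZY
  have hY0 : 0 < Y := by linarith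
  have hδY : 1 ≤ δ * Y := by
    have := hZ1.trans hZY
    rwa [div_le_iff₀' hδ] at this
  have hY8 : 1 ≤ Y ^ 8 := one_le_pow₀ (by linarith)
  have hT1 : (1 : ℝ) ≤ T := hY8.trans hT
  have hTD1 : 1 ≤ T * D := one_le_mul_of_one_le_of_one_le hT1 hD1
  have hTD0 : 0 < T * D := by linarith
  rw [mul_assoc] at hH
  have hTDX : T * D * Y ^ 50 ≤ X := by
    rwa [inv_mul_eq_div, le_div_iff₀ (by positivity)] at hTD
  have hHTD : H * Y ^ 50 ≤ T * D := by
    rwa [inv_mul_eq_div, le_div_iff₀ (by positivity)] at hH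
  have hXpos : (0 : ℝ) < X := lt_of_lt_of_le (by positivity) hTDX
  have hX0 : 0 < X := by exact_mod_cast hXpos
  -- the ambient cyclic group
  set B := ⌈4 * (T * D)⌉₊ with hB
  have hB1 : 4 * (T * D) ≤ B := Nat.le_ceil _
  have hB2 : (B : ℝ) < 4 * (T * D) + 1 := Nat.ceil_lt_add_one (by positivity)
  set N := X + B + B + 1 with hN
  have hNX : (N : ℝ) - X ≤ 11 * (T * D) := by
    rw [hN]; push_cast; linarith
  have hN0 : (0 : ℝ) < N := by rw [hN]; positivity
  have hY50 : 256 ≤ Y ^ 50 := hY256.trans (le_self_pow₀ (by linarith) (by norm_num))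
  have hN2 : 3 * (N : ℝ) ≤ 4 * X := by
    nlinarith
  set G := truncZMod N (X + B) f with hG
  have hSB : ∀ s ∈ S, (T : ℤ) * |s| ≤ B := fun s hs => by
    have h1 : (T : ℝ) * |(s : ℝ)| ≤ B := by
      refine le_trans ?_ hB1
      nlinarith [hSD s hs]
    exact_mod_cast h1
  have hmass : ∑ k, ‖ZMod.dft G k‖ ^ 2 ≤ (N : ℝ) ^ 2 := by
    rw [ZMod.sum_norm_sq_dft, sq]
    gcongr
    refine (Finset.sum_le_card_nsmul _ _ 1 fun x _ =>
      pow_le_one₀ (norm_nonneg _) (norm_truncZMod_le hf x)).trans_eq ?_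
    rw [card_univ, ZMod.card, nsmul_eq_mul, mul_one]
  have hlarge : δ * X * N ≤ ∑ k, ‖ZMod.dft G k‖ ^ 2 * avgR S (fun s =>
      ‖avgC (Icc 1 T) fun t => eC ((k.val : ℝ) / N * ((t * s : ℤ) : ℝ))‖ ^ 2) := by
    refine le_trans ?_ (avg_le_sum_dft le_rfl (by omega) hSB f)
    have h1 : δ ≤ avgR (Icc 1 X) fun n : ℕ => avgR S fun s =>
        ‖avgC (Icc 1 T) fun t : ℕ => ext0 f ((n : ℤ) + (t : ℤ) * s)‖ ^ 2 := by
      rw [← avgC_ofReal_re]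
      simp_rw [← avgC_avgC_avgC_mul_conj]
      exact hyp
    rw [avgR, Nat.card_Icc, Nat.add_sub_cancel, le_div_iff₀ hXpos] at h1
    rw [mul_comm]
    gcongr
  obtain ⟨q, hq0, hq, Θ, hΘ, hsum⟩ := exists_large_class (δ := δ) (Q := Y ^ 8)
    (C := δ * N * X / 3) hδ.le hY8 (by positivity) (g := fun k => ‖ZMod.dft G k‖ ^ 2)
    (w := fun k => avgR S fun s =>
      ‖avgC (Icc 1 T) fun t => eC ((k.val : ℝ) / N * ((t * s : ℤ) : ℝ))‖ ^ 2)
    (P := fun q k => dZ (q * ((k.val : ℝ) / N)) ≤ 128 * Y ^ 8 / (T * D))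
    (fun k => by positivity)
    (fun k => avgR_le hS fun s _ => pow_le_one₀ (norm_nonneg _)
      (norm_avgC_le_one _ fun _ _ => (norm_eC _).le))
    (by
      refine le_trans ?_ hlarge
      have h1 : δ / 2 * ∑ k, ‖ZMod.dft G k‖ ^ 2 ≤ δ / 2 * (N : ℝ) ^ 2 := by gcongr
      nlinarith [mul_le_mul_of_nonneg_left hN2 (mul_pos hδ hN0).le])
    (fun k hk => hden _ hk)
  refine ⟨q, hq0, hq, ?_⟩
  have hHq : (H : ℝ) * q ≤ B := by
    have h1 : (H : ℝ) * q ≤ H * Y ^ 50 := by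
      gcongr
      exact hq.trans (pow_le_pow_right₀ (by linarith) (by norm_num))
    linarith
  have hHB : H * q ≤ B := by exact_mod_cast hHq
  have hU := le_U1Sq_of_sum_dft (N := N) (M := X + B) (X := X) (H := H) (q := q) (by omega)
    (by omega) hX0 hH0 (by omega) hf Θ (fun k hk => by
      refine (mul_le_mul_of_nonneg_left (hΘ k hk) (Nat.cast_nonneg H)).trans ?_
      rw [mul_div_assoc', div_le_iff₀ hTD0]
      have h1 : (2048 : ℝ) ≤ Y ^ 42 :=
        calc (2048 : ℝ) ≤ 256 ^ 2 := by norm_num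
          _ ≤ Y ^ 2 := by gcongr
          _ ≤ Y ^ 42 := pow_le_pow_right₀ (by linarith) (by norm_num)
      have h2 : (H : ℝ) * Y ^ 8 * 2048 ≤ H * Y ^ 8 * Y ^ 42 := by gcongr
      have h3 : (H : ℝ) * Y ^ 8 * Y ^ 42 = H * Y ^ 50 := by ring
      linarith)
  have hU2 : δ * X / (12 * Y ^ 8) ≤ X * U1Sq X q H f + (N - X) := by
    have h1 : N * (δ * X / (12 * Y ^ 8)) ≤ N * (X * U1Sq X q H f + (N - X)) := by
      refine le_trans ?_ hU
      refine le_trans (le_of_eq ?_) (div_le_div_of_nonneg_right hsum (by norm_num))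
      field_simp
      norm_num
    exact le_of_mul_le_mul_left h1 hN0
  have hU3 := inv_pow_le_of_mass hδ hY256 hδY hXpos hNX hTDX hU2
  rw [U1norm]
  refine Real.le_sqrt_of_sq_le ?_
  refine le_trans (le_of_eq ?_) hU3
  rw [inv_pow, ← pow_mul]
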